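/- arXiv:2003.03502 — 7 statements merged into one kernel-verified Lean document; each statement's English description precedes it below -/
import Mathlib

section
/- Let n ≥ 1 and let w ∈ ℝⁿ (with the Euclidean norm). Denote by w₊ the componentwise positive part of w, i.e. (w₊)ᵢ = max(wᵢ, 0), and assume w₊ ≠ 0. Then the point w₊/‖w₊‖ is a nearest point to w in the set {x ∈ ℝⁿ : xᵢ ≥ 0 for all i and ‖x‖ = 1}; that is, for every y ∈ ℝⁿ with yᵢ ≥ 0 for all i and ‖y‖ = 1, one has ‖w − w₊/‖w₊‖‖ ≤ ‖w − y‖. -/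
/-- The inner product of a vector with its positive part is the squared norm of the latter. -/
theorem inner_posPart_eq_norm_sq {ι : Type*} [Fintype ι] {w wp : EuclideanSpace ℝ ι}
    (hwp : ∀ i, wp i = max (w i) 0) : inner ℝ w wp = ‖wp‖ ^ 2 := by
  rw [← real_inner_self_eq_norm_sq, PiLp.inner_apply, PiLp.inner_apply]
  refine Finset.sum_congr rfl fun i _ => ?_
  rcases le_total (w i) 0 with h | h <;> simp [hwp i, h]

/-- Against a nonnegative vector, the inner product increases on taking positive parts. -/
theorem inner_le_inner_posPart {ι : Type*} [Fintype ι] {w wp y : EuclideanSpace ℝ ι}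
    (hwp : ∀ i, wp i = max (w i) 0) (hy : ∀ i, 0 ≤ y i) : inner ℝ w y ≤ inner ℝ wp y := by
  rw [PiLp.inner_apply, PiLp.inner_apply]
  refine Finset.sum_le_sum fun i _ => ?_
  have h : w i ≤ wp i := (hwp i).symm ▸ le_max_left _ _
  simpa using mul_le_mul_of_nonneg_left h (hy i)

/-- Among vectors of equal norm, a larger inner product with `w` means a smaller distance. -/
theorem norm_sub_le_norm_sub_of_inner_le {E : Type*} [NormedAddCommGroup E]
    [InnerProductSpace ℝ E] {w x y : E} (hxy : ‖x‖ = ‖y‖) (h : inner ℝ w y ≤ inner ℝ w x) :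
    ‖w - x‖ ≤ ‖w - y‖ := by
  refine (sq_le_sq₀ (norm_nonneg _) (norm_nonneg _)).1 ?_
  rw [norm_sub_sq_real, norm_sub_sq_real, hxy]
  linarith

/-- Projection onto the intersection of the unit sphere and the nonnegative
orthant: the normalized positive part `w₊/‖w₊‖` is a nearest point to `w`
in `{x : x ≥ 0, ‖x‖ = 1}`. -/
theorem positivePart_normalize_is_projection
    (n : ℕ) (hn : 1 ≤ n) (w : EuclideanSpace ℝ (Fin n))
    (wp : EuclideanSpace ℝ (Fin n)) (hwp : ∀ i, wp i = max (w i) 0)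
    (hne : wp ≠ 0) :
    ∀ y : EuclideanSpace ℝ (Fin n), (∀ i, 0 ≤ y i) → ‖y‖ = 1 →
      ‖w - ‖wp‖⁻¹ • wp‖ ≤ ‖w - y‖ := by
  intro y hy hy1
  have hpos : ‖wp‖ ≠ 0 := norm_ne_zero_iff.2 hne
  refine norm_sub_le_norm_sub_of_inner_le ?_ ?_
  · rw [hy1, norm_smul, norm_inv, norm_norm, inv_mul_cancel₀ hpos]
  · calc inner ℝ w y ≤ inner ℝ wp y := inner_le_inner_posPart hwp hy
      _ ≤ ‖wp‖ * ‖y‖ := real_inner_le_norm wp y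
      _ = inner ℝ w (‖wp‖⁻¹ • wp) := by
        rw [hy1, real_inner_smul_right, inner_posPart_eq_norm_sq hwp]
        field_simp
end

section
/- Let E be a real inner product space, let C ⊆ E be a nonempty set, let γ > 0, and let f : E → ℝ be differentiable at x with gradient ∇f(x). Define φ_γ(x) := f(x) − (γ/2)‖∇f(x)‖² + (1/(2γ))·dist(x − γ∇f(x), C)². Then for every x ∈ C, φ_γ(x) ≤ f(x). -/
open scoped RealInnerProductSpace

/-- Part 1 of the FBE lemma: the forward-backward envelope is a lower bound
for `f` on the constraint set `C`. -/
theorem fbe_le_f_on_C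
    {E : Type*} [NormedAddCommGroup E] [InnerProductSpace ℝ E]
    (C : Set E) (hC : C.Nonempty) (γ : ℝ) (hγ : 0 < γ)
    (f : E → ℝ) (x : E) (g : E) (hg : HasFDerivAt f (innerSL ℝ g) x)
    (hx : x ∈ C) :
    f x - (γ / 2) * ‖g‖ ^ 2
        + (1 / (2 * γ)) * (Metric.infDist (x - γ • g) C) ^ 2 ≤ f x := by
  have hdist : Metric.infDist (x - γ • g) C ≤ γ * ‖g‖ := by
    simpa [dist_eq_norm, norm_smul, abs_of_pos hγ] using
      Metric.infDist_le_dist_of_mem (x := x - γ • g) hx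
  have hsq : (1 / (2 * γ)) * Metric.infDist (x - γ • g) C ^ 2 ≤ (γ / 2) * ‖g‖ ^ 2 :=
    calc (1 / (2 * γ)) * Metric.infDist (x - γ • g) C ^ 2
        ≤ (1 / (2 * γ)) * (γ * ‖g‖) ^ 2 := by
          have := Metric.infDist_nonneg (x := x - γ • g) (s := C)
          gcongr
      _ = (γ / 2) * ‖g‖ ^ 2 := by field_simp
  linarith
end

section
/- Let E be a real inner product space, let C ⊆ E be a nonempty set, let γ > 0 and L > 0, and let f : E → ℝ be differentiable at x with gradient ∇f(x). Define φ_γ(x) := f(x) − (γ/2)‖∇f(x)‖² + (1/(2γ))·dist(x − γ∇f(x), C)². Suppose z ∈ C attains the projection, i.e. ‖(x − γ∇f(x)) − z‖ = dist(x − γ∇f(x), C), and suppose the descent inequality f(z) ≤ f(x) + ⟨∇f(x), z − x⟩ + (L/2)‖x − z‖² holds. Then f(z) ≤ φ_γ(x) − ((1 − γL)/(2γ))·‖x − z‖². -/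
open scoped RealInnerProductSpace

/-- Part 2 of the FBE lemma: if `z ∈ C` is a forward-backward (projected
gradient) step from `x` and the descent inequality with modulus `L` holds,
then `f(z) ≤ φ_γ(x) − ((1 − γL)/(2γ))‖x − z‖²`. -/
theorem fbe_sufficient_decrease
    {E : Type*} [NormedAddCommGroup E] [InnerProductSpace ℝ E]
    (C : Set E) (hC : C.Nonempty) (γ L : ℝ) (hγ : 0 < γ) (hL : 0 < L)
    (f : E → ℝ) (x : E) (g : E) (hg : HasFDerivAt f (innerSL ℝ g) x)
    (z : E) (hzC : z ∈ C)
    (hproj : ‖(x - γ • g) - z‖ = Metric.infDist (x - γ • g) C)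
    (hdesc : f z ≤ f x + ⟪g, z - x⟫ + (L / 2) * ‖x - z‖ ^ 2) :
    f z ≤ (f x - (γ / 2) * ‖g‖ ^ 2
            + (1 / (2 * γ)) * (Metric.infDist (x - γ • g) C) ^ 2)
          - ((1 - γ * L) / (2 * γ)) * ‖x - z‖ ^ 2 := by
  have hexpand : ‖(x - γ • g) - z‖ ^ 2
      = ‖x - z‖ ^ 2 + 2 * γ * ⟪g, z - x⟫ + γ ^ 2 * ‖g‖ ^ 2 := by
    rw [show (x - γ • g) - z = (x - z) - γ • g by abel, norm_sub_sq_real,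
      real_inner_smul_right, norm_smul, mul_pow, Real.norm_eq_abs, sq_abs,
      real_inner_comm, ← neg_sub z x, inner_neg_right]
    ring
  rw [← hproj, hexpand]
  refine hdesc.trans_eq ?_
  field_simp
  ring
end

section
/- Let E be a real inner product space, let C ⊆ E be a nonempty set, let L > 0, 0 < γ ≤ 1/L, and let f : E → ℝ be a nonnegative function differentiable at x with gradient ∇f(x). Define φ_γ(x) := f(x) − (γ/2)‖∇f(x)‖² + (1/(2γ))·dist(x − γ∇f(x), C)². Suppose z ∈ C satisfies ‖(x − γ∇f(x)) − z‖ = dist(x − γ∇f(x), C) and f(z) ≤ f(x) + ⟨∇f(x), z − x⟩ + (L/2)‖x − z‖². Then φ_γ(x) ≥ f(z) ≥ 0. -/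
open scoped RealInnerProductSpace

/-- Nonnegativity consequence of part 2 of the FBE lemma: if `f ≥ 0`, `γ ≤ 1/L`,
`z ∈ C` is a projected gradient step from `x`, and the descent inequality holds,
then `φ_γ(x) ≥ f(z) ≥ 0`. -/
theorem fbe_nonneg
    {E : Type*} [NormedAddCommGroup E] [InnerProductSpace ℝ E]
    (C : Set E) (hC : C.Nonempty) (γ L : ℝ) (hL : 0 < L)
    (hγ : 0 < γ) (hγL : γ ≤ 1 / L)
    (f : E → ℝ) (hf : ∀ y, 0 ≤ f y)
    (x : E) (g : E) (hg : HasFDerivAt f (innerSL ℝ g) x)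
    (z : E) (hzC : z ∈ C)
    (hproj : ‖(x - γ • g) - z‖ = Metric.infDist (x - γ • g) C)
    (hdesc : f z ≤ f x + ⟪g, z - x⟫ + (L / 2) * ‖x - z‖ ^ 2) :
    0 ≤ f z ∧
      f z ≤ f x - (γ / 2) * ‖g‖ ^ 2
            + (1 / (2 * γ)) * (Metric.infDist (x - γ • g) C) ^ 2 := by
  refine ⟨hf z, ?_⟩
  have hexpand : ‖(x - γ • g) - z‖ ^ 2
      = ‖x - z‖ ^ 2 + 2 * γ * ⟪g, z - x⟫ + γ ^ 2 * ‖g‖ ^ 2 := by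
    rw [sub_right_comm, norm_sub_sq_real, real_inner_smul_right, norm_smul, mul_pow,
      Real.norm_eq_abs, sq_abs, real_inner_comm, ← neg_sub z x, inner_neg_right, norm_neg]
    ring
  have hL_le : L ≤ 1 / γ := (le_one_div hγ hL).mp hγL
  have hquad : (L / 2) * ‖x - z‖ ^ 2 ≤ (1 / γ / 2) * ‖x - z‖ ^ 2 := by gcongr
  have henv : f x - (γ / 2) * ‖g‖ ^ 2 + (1 / (2 * γ)) * ‖(x - γ • g) - z‖ ^ 2
      = f x + ⟪g, z - x⟫ + (1 / γ / 2) * ‖x - z‖ ^ 2 := by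
    rw [hexpand]
    field_simp
    ring
  rw [← hproj, henv]
  linarith
end

section
/- Let N ≥ 1 and R ≥ 1, let I : Fin N → ℕ give the tensor dimensions, let a(n, r) ∈ ℝ^{I(n)} for n ∈ Fin N and r ∈ Fin R be factor vectors, let λ ∈ ℝ^R, and let T be a real tensor with entries T(i) for multi-indices i ∈ Π_{n} Fin (I(n)). Let k(n, r) ∈ ℝ for n ∈ {1, …, N+1} and r ∈ {1, …, R} satisfy Σ_{n=1}^{N+1} k(n, r) = 0 for every r. Then for every multi-index i, the function g : ℝ → ℝ defined by g(t) = Σ_{r=1}^{R} (λ_r + t·k(N+1, r)·λ_r) · Π_{n=1}^{N} (a(n,r)(i_n) + t·k(n, r)·a(n,r)(i_n)) − T(i) has derivative 0 at t = 0. -/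
open scoped BigOperators

/-- Moving each factor `c j` of a product in the direction `k j * c j` changes the product, to first
order, by the factor `∑ j, k j`. -/
theorem hasDerivAt_prod_add_mul_self {ι : Type*} (s : Finset ι) (c k : ι → ℝ) :
    HasDerivAt (fun t : ℝ => ∏ j ∈ s, (c j + t * k j * c j))
      ((∑ j ∈ s, k j) * ∏ j ∈ s, c j) 0 := by
  classical
  induction s using Finset.induction_on with
  | empty => simpa using hasDerivAt_const (0 : ℝ) (1 : ℝ)
  | insert j s hj ih =>
    have h : HasDerivAt (fun t : ℝ => c j + t * k j * c j) (1 * k j * c j) 0 :=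
      (((hasDerivAt_id (0 : ℝ)).mul_const (k j)).mul_const (c j)).const_add (c j)
    simp only [Finset.prod_insert hj, Finset.sum_insert hj]
    refine (h.fun_mul ih).congr_deriv ?_
    simp only [zero_mul, add_zero]
    ring

/-- Kernel of the Jacobian of the CPD residual map (computation `JF(x)·K = 0` in
Lemma 2): if `Σ_{n=1}^{N+1} k(n,r) = 0` for every `r`, then for every entry `i`
of the tensor, the scalar function
`t ↦ Σ_r (λ_r + t·k(N+1,r)·λ_r)·Π_n (a(n,r)(i_n) + t·k(n,r)·a(n,r)(i_n)) − T(i)`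
has derivative `0` at `t = 0`. -/
theorem cpd_scaling_direction_in_kernel
    (N R : ℕ) (hN : 1 ≤ N) (hR : 1 ≤ R) (I : Fin N → ℕ)
    (a : (n : Fin N) → Fin R → EuclideanSpace ℝ (Fin (I n)))
    (lam : Fin R → ℝ)
    (T : ((n : Fin N) → Fin (I n)) → ℝ)
    (k : Fin (N + 1) → Fin R → ℝ)
    (hk : ∀ r : Fin R, ∑ n : Fin (N + 1), k n r = 0)
    (i : (n : Fin N) → Fin (I n)) :
    HasDerivAt (fun t : ℝ =>
      (∑ r : Fin R, (lam r + t * k (Fin.last N) r * lam r) *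
        ∏ n : Fin N, (a n r (i n) + t * k n.castSucc r * a n r (i n))) - T i)
      0 0 := by
  have hterm (r : Fin R) : HasDerivAt (fun t : ℝ =>
      (lam r + t * k (Fin.last N) r * lam r) *
        ∏ n : Fin N, (a n r (i n) + t * k n.castSucc r * a n r (i n))) 0 0 := by
    have h := hasDerivAt_prod_add_mul_self Finset.univ
      (Fin.snoc (α := fun _ => ℝ) (fun n => a n r (i n)) (lam r)) (fun n => k n r)
    rw [hk r, zero_mul] at h
    simpa only [Fin.prod_univ_castSucc, Fin.snoc_castSucc, Fin.snoc_last, mul_comm] using h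
  simpa using (HasDerivAt.fun_sum fun r _ => hterm r).sub_const (T i)
end

section
/- Let N ≥ 1 and R ≥ 1, let I : Fin N → ℕ, let a(n, r) ∈ ℝ^{I(n)} be nonzero vectors for all n ∈ Fin N, r ∈ Fin R, and let λ ∈ ℝ^R with λ_r ≠ 0 for all r. Consider the linear map Φ sending k : Fin (N+1) → Fin R → ℝ to the tuple of directions (d, μ) with d(n, r) = k(n, r) · a(n, r) for n ≤ N and μ_r = k(N+1, r) · λ_r. Then the image under Φ of the subspace V = {k : Σ_{n=1}^{N+1} k(n, r) = 0 for every r} is a linear subspace of dimension exactly N·R. -/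
open scoped BigOperators

/-- The matrices with `N + 1` rows whose columns all sum to zero are parametrized by their
first `N` rows. -/
theorem finrank_of_mem_iff_sum_eq_zero {K : Type*} [Field K] (N R : ℕ)
    (V : Submodule K (Fin (N + 1) → Fin R → K))
    (hV : ∀ k, k ∈ V ↔ ∀ r : Fin R, ∑ n : Fin (N + 1), k n r = 0) :
    Module.finrank K V = N * R := by
  let f : V →ₗ[K] (Fin N → Fin R → K) :=
    (LinearMap.funLeft K (Fin R → K) Fin.castSucc).domRestrict V
  have hf : Function.Bijective f := by
    constructor
    · rw [← LinearMap.ker_eq_bot, LinearMap.ker_eq_bot']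
      rintro ⟨k, hk⟩ hfk
      have hinit : ∀ n r, k (Fin.castSucc n) r = 0 := fun n r =>
        congrFun (congrFun hfk n) r
      ext n r
      refine Fin.lastCases ?_ (fun i => hinit i r) n
      simpa [Fin.sum_univ_castSucc, hinit] using (hV k).1 hk r
    · intro k
      refine ⟨⟨Fin.snoc (α := fun _ => Fin R → K) k (fun r => -∑ n, k n r), ?_⟩, ?_⟩
      · rw [hV]
        intro r
        simp [Fin.sum_univ_castSucc]
      · ext n r
        simp [f, LinearMap.funLeft_apply]
  rw [(LinearEquiv.ofBijective f hf).finrank_eq]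
  simp [Module.finrank_pi_fintype]

/-- Lemma 2 (Kernel of the Gramian), dimension count: the image under
`Φ : k ↦ (k(n,r)·a(n,r), k(N+1,r)·λ_r)` of the subspace
`V = {k : Σ_{n=1}^{N+1} k(n,r) = 0 ∀r}` has dimension exactly `N·R`,
provided all factor vectors `a(n,r)` and weights `λ_r` are nonzero. -/
theorem cpd_gramian_kernel_dim
    (N R : ℕ) (hN : 1 ≤ N) (hR : 1 ≤ R) (I : Fin N → ℕ)
    (a : (n : Fin N) → Fin R → EuclideanSpace ℝ (Fin (I n)))
    (ha : ∀ n r, a n r ≠ 0)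
    (lam : Fin R → ℝ) (hlam : ∀ r, lam r ≠ 0)
    (Φ : (Fin (N + 1) → Fin R → ℝ) →ₗ[ℝ]
      ((n : Fin N) → Fin R → EuclideanSpace ℝ (Fin (I n))) × (Fin R → ℝ))
    (hΦ : ∀ k, Φ k =
      (fun n r => k n.castSucc r • a n r, fun r => k (Fin.last N) r * lam r))
    (V : Submodule ℝ (Fin (N + 1) → Fin R → ℝ))
    (hV : ∀ k, k ∈ V ↔ ∀ r : Fin R, ∑ n : Fin (N + 1), k n r = 0) :
    Module.finrank ℝ (Submodule.map Φ V) = N * R := by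
  have hinj : Function.Injective Φ := by
    rw [← LinearMap.ker_eq_bot, LinearMap.ker_eq_bot']
    intro k hk
    rw [hΦ, Prod.mk_eq_zero] at hk
    ext n r
    refine Fin.lastCases ?_ (fun i => ?_) n
    · exact (mul_eq_zero.1 (congrFun hk.2 r)).resolve_right (hlam r)
    · exact (smul_eq_zero.1 (congrFun (congrFun hk.1 i) r)).resolve_right (ha i r)
  rw [← (Submodule.equivMapOfInjective Φ hinj V).finrank_eq]
  exact finrank_of_mem_iff_sum_eq_zero N R V hV
end

section
/- Let E be a finite-dimensional real inner product space, let γ > 0, and let P, G : E → E be linear maps such that P is self-adjoint and idempotent (P∘P = P), G is self-adjoint and positive semidefinite (⟨v, G v⟩ ≥ 0 for all v), and range(P) ∩ ker(G) = {0}. Then the linear map id − P + γ·(P ∘ G) is invertible (bijective). -/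
open scoped RealInnerProductSpace

/-- A symmetric positive semidefinite operator annihilates every vector on which its quadratic form
vanishes. -/
theorem LinearMap.IsSymmetric.apply_eq_zero_of_inner_self_eq_zero
    {E : Type*} [NormedAddCommGroup E] [InnerProductSpace ℝ E] {G : E →ₗ[ℝ] E}
    (hGsym : LinearMap.IsSymmetric G) (hGpsd : ∀ v : E, 0 ≤ ⟪v, G v⟫) {v : E}
    (hv : ⟪v, G v⟫ = 0) : G v = 0 := by
  have hquad : ∀ t : ℝ, 0 ≤ ⟪G v, G (G v)⟫ * (t * t) + (-2 * ⟪G v, G v⟫) * t + 0 := by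
    intro t
    have h := hGpsd (v - t • G v)
    have hswap : ⟪v, G (G v)⟫ = ⟪G v, G v⟫ := (hGsym v (G v)).symm
    simp only [map_sub, map_smul, inner_sub_left, inner_sub_right, real_inner_smul_left,
      real_inner_smul_right, hv, hswap] at h
    linarith
  have hdiscrim := discrim_le_zero hquad
  have hzero : ⟪G v, G v⟫ = 0 := by
    rw [discrim] at hdiscrim
    nlinarith
  exact inner_self_eq_zero.mp hzero

/-- Core linear-algebra step of Theorem 2: if `P` is a self-adjoint idempotent,
`G` is self-adjoint positive semidefinite, and `range(P) ∩ ker(G) = {0}`, then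
`I − P + γ·P∘G` is invertible for every `γ > 0`. -/
theorem gn_jacobian_nonsingular
    {E : Type*} [NormedAddCommGroup E] [InnerProductSpace ℝ E]
    [FiniteDimensional ℝ E]
    (γ : ℝ) (hγ : 0 < γ) (P G : E →ₗ[ℝ] E)
    (hPsym : LinearMap.IsSymmetric P) (hPidem : P ∘ₗ P = P)
    (hGsym : LinearMap.IsSymmetric G) (hGpsd : ∀ v : E, 0 ≤ ⟪v, G v⟫)
    (hrk : LinearMap.range P ⊓ LinearMap.ker G = ⊥) :
    Function.Bijective ⇑((LinearMap.id : E →ₗ[ℝ] E) - P + γ • (P ∘ₗ G)) := by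
  have hPP : ∀ w, P (P w) = P w := fun w => LinearMap.congr_fun hPidem w
  set H : E →ₗ[ℝ] E := LinearMap.id - P + γ • (P ∘ₗ G) with hH
  have hinj : Function.Injective H := by
    rw [injective_iff_map_eq_zero]
    intro v hv
    have hv' : v - P v + γ • P (G v) = 0 := by simpa [hH] using hv
    have hPG : P (G v) = 0 := by
      have h := congrArg P hv'
      simpa [hPP, hγ.ne'] using h
    have hPv : P v = v := by
      rw [hPG, smul_zero, add_zero, sub_eq_zero] at hv'
      exact hv'.symm
    have hform : ⟪v, G v⟫ = 0 := by
      rw [← hPv, hPsym, hPv, hPG, inner_zero_right]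
    have hmem : v ∈ LinearMap.range P ⊓ LinearMap.ker G :=
      ⟨⟨v, hPv⟩, hGsym.apply_eq_zero_of_inner_self_eq_zero hGpsd hform⟩
    simpa [hrk] using hmem
  exact ⟨hinj, LinearMap.surjective_of_injective hinj⟩
end
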